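/- Let α ∈ ℝ^K with α_j > 0 for all j, S = Σ_j α_j, and let p ~ Dir(α). Then the expected Shannon entropy satisfies E_{p ~ Dir(α)}[H(p)] = Σ_{k=1}^K (α_k / S) (ψ(S + 1) − ψ(α_k + 1)), where H(p) = −Σ_k p_k log p_k and ψ is the digamma function. -/

import Mathlib

open MeasureTheory Real

/-- The multivariate Beta function `B(α) = (∏ j, Γ(α j)) / Γ(∑ j, α j)`. -/
noncomputable def multiBeta {K : ℕ} (α : Fin K → ℝ) : ℝ :=
  (∏ j, Real.Gamma (α j)) / Real.Gamma (∑ j, α j)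

/-- The density of the Dirichlet distribution `Dir(α)` on the probability simplex
`Δ^{K-1} ⊆ ℝ^{n+1}` (with `K = n + 1`), expressed in the coordinates
`x = (p 0, …, p (n-1)) ∈ ℝ^n` of the first `n` components; the last component is
`p n = 1 - ∑ i, x i`.  On the open coordinate domain
`{x | ∀ i, 0 < x i ∧ ∑ i, x i < 1}` the density is `(1 / B(α)) ∏ j, p j ^ (α j - 1)`,
and it vanishes elsewhere. -/
noncomputable def dirichletDensity {n : ℕ} (α : Fin (n + 1) → ℝ) (x : Fin n → ℝ) : ℝ :=
  if (∀ i, 0 < x i) ∧ (∑ i, x i) < 1 then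
    (1 / multiBeta α) * ∏ j, (Fin.snoc x (1 - ∑ i, x i) j) ^ (α j - 1)
  else 0

/-- The Dirichlet distribution `Dir(α)` as a measure on `ℝ^{n+1}` supported on the
probability simplex: the image, under the parametrization
`x ↦ (x 0, …, x (n-1), 1 - ∑ i, x i)` of the simplex by its first `n` coordinates, of the
measure on `ℝ^n` with density `dirichletDensity α` with respect to Lebesgue measure
(this realizes the density `(1 / B(α)) ∏ j, p j ^ (α j - 1)` with respect to the
`(K-1)`-dimensional Lebesgue measure on the simplex). -/
noncomputable def dirichlet {n : ℕ} (α : Fin (n + 1) → ℝ) :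
    Measure (Fin (n + 1) → ℝ) :=
  ((volume : Measure (Fin n → ℝ)).withDensity
      (fun x => ENNReal.ofReal (dirichletDensity α x))).map
    (fun x => Fin.snoc x (1 - ∑ i, x i))

/-- The digamma function `ψ(x) = d/dx log Γ(x) = Γ'(x) / Γ(x)`. -/
noncomputable def digamma (x : ℝ) : ℝ :=
  deriv (fun t => Real.log (Real.Gamma t)) x

open scoped ENNReal

noncomputable def dg (a t : ℝ) : ℝ≥0∞ := ENNReal.ofReal (if 0 < t then t ^ (a - 1) else 0)

lemma dg_meas (a : ℝ) : Measurable (dg a) := by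
  unfold dg
  refine ENNReal.measurable_ofReal.comp (Measurable.ite measurableSet_Ioi ?_ measurable_const)
  fun_prop

lemma dg_comp_meas {X : Type*} [MeasurableSpace X] (a : ℝ) {f : X → ℝ} (hf : Measurable f) :
    Measurable (fun x => dg a (f x)) := (dg_meas a).comp hf

lemma dg_scale (a : ℝ) {s : ℝ} (hs : 0 < s) (t : ℝ) :
    dg a (s * t) = ENNReal.ofReal (s ^ (a - 1)) * dg a t := by
  unfold dg
  rw [← ENNReal.ofReal_mul (by positivity)]
  by_cases ht : 0 < t
  · rw [if_pos ht, if_pos (mul_pos hs ht), Real.mul_rpow hs.le ht.le]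
  · have : ¬ 0 < s * t := fun h => ht (pos_of_mul_pos_right h hs.le)
    rw [if_neg ht, if_neg this]; simp

lemma dg_zero (a : ℝ) {t : ℝ} (ht : t ≤ 0) : dg a t = 0 := by
  simp [dg, not_lt.mpr ht]

lemma dg_gamma {a : ℝ} (ha : 0 < a) :
    ∫⁻ t, dg a t * ENNReal.ofReal (Real.exp (-t)) = ENNReal.ofReal (Real.Gamma a) := by
  rw [Real.Gamma_eq_integral ha, ofReal_integral_eq_lintegral_ofReal
    (Real.GammaIntegral_convergent ha), ← lintegral_indicator measurableSet_Ioi]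
  · congr 1
    ext t
    by_cases ht : 0 < t
    · rw [Set.indicator_of_mem (show t ∈ Set.Ioi 0 from ht), dg, if_pos ht,
        ← ENNReal.ofReal_mul (by positivity), mul_comm]
    · rw [Set.indicator_of_notMem (by simpa using ht), dg_zero _ (not_lt.mp ht), zero_mul]
  · filter_upwards [ae_restrict_mem measurableSet_Ioi] with t ht
    have : 0 < t := ht
    simp only [Pi.zero_apply]; positivity

lemma lint_prod : ∀ {n : ℕ} (f : Fin n → ℝ → ℝ≥0∞) (_ : ∀ i, Measurable (f i)),
    ∫⁻ x : Fin n → ℝ, ∏ i, f i (x i) = ∏ i, ∫⁻ t, f i t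
  | 0, f, hf => by simp [volume_pi]
  | n + 1, f, hf => by
    have h := (volume_preserving_piFinSuccAbove (fun _ : Fin (n+1) => ℝ) 0).symm
    have hM : Measurable (fun x : Fin (n+1) → ℝ => ∏ i, f i (x i)) :=
      Finset.measurable_fun_prod _ (fun i _ => (hf i).comp (measurable_pi_apply i))
    rw [← h.lintegral_comp hM]
    simp only [Fin.prod_univ_succ]
    rw [← lint_prod (fun i => f i.succ) (fun i => hf _), ← lintegral_prod_mul (hf 0).aemeasurable]
    · rfl
    · exact (Finset.measurable_prod _ (fun i _ => (hf _).comp (measurable_pi_apply i))).aemeasurable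

lemma lint_scale {n : ℕ} (F : (Fin n → ℝ) → ℝ≥0∞) (hF : Measurable F) {s : ℝ} (hs : 0 < s) :
    ∫⁻ x, F x = ENNReal.ofReal (s ^ n) * ∫⁻ x, F (s • x) := by
  have h := Measure.map_addHaar_smul (volume : Measure (Fin n → ℝ)) hs.ne'
  have h2 : ∫⁻ x, F (s • x) = ∫⁻ x, F x ∂(Measure.map (s • ·) volume) :=
    (lintegral_map hF (measurable_const_smul s)).symm
  rw [h2, h, lintegral_smul_measure, smul_eq_mul, ← mul_assoc, ← ENNReal.ofReal_mul (by positivity)]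
  have : s ^ n * |(s ^ Module.finrank ℝ (Fin n → ℝ))⁻¹| = 1 := by
    rw [abs_of_pos (by positivity), Module.finrank_fin_fun]
    field_simp
  rw [this]; simp

lemma Fmeas {n : ℕ} (α : Fin (n + 1) → ℝ) {X : Type*} [MeasurableSpace X] (f : X → Fin n → ℝ)
    (g : X → ℝ) (hf : Measurable f) (hg : Measurable g) :
    Measurable (fun x => (∏ i : Fin n, dg (α i.castSucc) (f x i)) *
      dg (α (Fin.last n)) (g x - ∑ i, f x i)) := by
  refine Measurable.mul (Finset.measurable_prod _ fun i _ => dg_comp_meas _ (by fun_prop))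
    (dg_comp_meas _ (by fun_prop))

lemma dir_int {n : ℕ} (α : Fin (n + 1) → ℝ) (hα : ∀ j, 0 < α j) :
    ∫⁻ x : Fin n → ℝ, (∏ i : Fin n, dg (α i.castSucc) (x i)) *
      dg (α (Fin.last n)) (1 - ∑ i, x i) = ENNReal.ofReal (multiBeta α) := by
  set Z := ∫⁻ x : Fin n → ℝ, (∏ i : Fin n, dg (α i.castSucc) (x i)) *
      dg (α (Fin.last n)) (1 - ∑ i, x i) with hZ
  have hS : 0 < ∑ j, α j := Finset.sum_pos (fun j _ => hα j) Finset.univ_nonempty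
  have hm : ∀ a, Measurable (fun t => dg a t * ENNReal.ofReal (Real.exp (-t))) := fun a =>
    (dg_meas a).mul (by fun_prop)
  have key : ENNReal.ofReal (∏ j, Real.Gamma (α j)) =
      ENNReal.ofReal (Real.Gamma (∑ j, α j)) * Z := by
    calc ENNReal.ofReal (∏ j, Real.Gamma (α j))
        = ∏ j, ∫⁻ t, dg (α j) t * ENNReal.ofReal (Real.exp (-t)) := by
          rw [ENNReal.ofReal_prod_of_nonneg (fun j _ => (Real.Gamma_pos_of_pos (hα j)).le)]
          exact Finset.prod_congr rfl fun j _ => (dg_gamma (hα j)).symm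
      _ = ∫⁻ x : Fin n → ℝ, ∫⁻ s : ℝ, ((∏ i : Fin n, dg (α i.castSucc) (x i)) *
            dg (α (Fin.last n)) (s - ∑ i, x i)) * ENNReal.ofReal (Real.exp (-s)) := by
          rw [Fin.prod_univ_castSucc, ← lint_prod _ (fun i => hm _), ← lintegral_mul_const]
          · refine lintegral_congr fun x => ?_
            rw [← lintegral_sub_right_eq_self _ (∑ i, x i), ← lintegral_const_mul]
            · refine lintegral_congr fun s => ?_
              rw [Finset.prod_mul_distrib, ← ENNReal.ofReal_prod_of_nonneg
                (fun _ _ => (Real.exp_pos _).le), ← Real.exp_sum]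
              have : Real.exp (-s) = Real.exp (∑ i, -x i) * Real.exp (-(s - ∑ i, x i)) := by
                rw [← Real.exp_add]; congr 1; rw [Finset.sum_neg_distrib]; ring
              rw [this, ENNReal.ofReal_mul (Real.exp_pos _).le]
              ring
            · exact (hm _).comp (by fun_prop)
          · exact Finset.measurable_prod _ fun i _ => (hm _).comp (measurable_pi_apply i)
      _ = ∫⁻ s : ℝ, ∫⁻ x : Fin n → ℝ, ((∏ i : Fin n, dg (α i.castSucc) (x i)) *
            dg (α (Fin.last n)) (s - ∑ i, x i)) * ENNReal.ofReal (Real.exp (-s)) := by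
          refine lintegral_lintegral_swap (Measurable.aemeasurable ?_)
          exact Measurable.mul (Fmeas α (fun p : (Fin n → ℝ) × ℝ => p.1) (fun p => p.2)
            measurable_fst measurable_snd) (by fun_prop)
      _ = ∫⁻ s : ℝ, (dg (∑ j, α j) s * ENNReal.ofReal (Real.exp (-s))) * Z := by
          refine lintegral_congr fun s => ?_
          have hF : Measurable (fun x : Fin n → ℝ => (∏ i : Fin n, dg (α i.castSucc) (x i)) *
            dg (α (Fin.last n)) (s - ∑ i, x i)) :=
            Fmeas α (fun x : (Fin n → ℝ) => x) (fun _ => s) measurable_id measurable_const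
          rw [lintegral_mul_const _ hF, mul_right_comm]
          congr 1
          by_cases hs : 0 < s
          · rw [lint_scale _ hF hs]
            have : ∀ x : Fin n → ℝ, (∏ i : Fin n, dg (α i.castSucc) ((s • x) i)) *
                dg (α (Fin.last n)) (s - ∑ i, (s • x) i) =
                (∏ j, ENNReal.ofReal (s ^ (α j - 1))) *
                ((∏ i : Fin n, dg (α i.castSucc) (x i)) *
                dg (α (Fin.last n)) (1 - ∑ i, x i)) := by
              intro x
              have e : s - ∑ i, (s • x) i = s * (1 - ∑ i, x i) := by
                simp only [Pi.smul_apply, smul_eq_mul, ← Finset.mul_sum]; ring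
              rw [e, dg_scale _ hs, Fin.prod_univ_castSucc]
              simp only [Pi.smul_apply, smul_eq_mul, dg_scale _ hs, Finset.prod_mul_distrib]
              ring
            simp only [this]
            rw [lintegral_const_mul _ (Fmeas α (fun x : (Fin n → ℝ) => x) (fun _ => 1)
              measurable_id measurable_const), ← mul_assoc]
            congr 1
            rw [← ENNReal.ofReal_prod_of_nonneg (fun j _ => by positivity),
              ← ENNReal.ofReal_mul (by positivity), dg, if_pos hs]
            congr 1
            rw [← Real.rpow_sum_of_pos hs, ← Real.rpow_natCast, ← Real.rpow_add hs]
            congr 1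
            rw [Finset.sum_sub_distrib]; simp; ring
          · rw [dg_zero _ (not_lt.mp hs), zero_mul]
            rw [← lintegral_zero (μ := (volume : Measure (Fin n → ℝ)))]
            refine lintegral_congr fun x => ?_
            by_cases hx : ∀ i, 0 < x i
            · rw [dg_zero, mul_zero]
              have := Finset.sum_nonneg (fun i (_ : i ∈ Finset.univ) => (hx i).le)
              linarith
            · push Not at hx
              obtain ⟨i, hi⟩ := hx
              rw [Finset.prod_eq_zero (Finset.mem_univ i) (dg_zero _ hi), zero_mul]
      _ = _ := by
          rw [lintegral_mul_const _ (hm _), dg_gamma hS]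
  have hG := Real.Gamma_pos_of_pos hS
  rw [multiBeta, ENNReal.ofReal_div_of_pos hG, key, mul_comm, ENNReal.mul_div_cancel_right]
  · simpa using hG
  · simp

lemma dens_eq {n : ℕ} (α : Fin (n + 1) → ℝ) (hα : ∀ j, 0 < α j) (x : Fin n → ℝ) :
    ENNReal.ofReal (dirichletDensity α x) = ENNReal.ofReal (1 / multiBeta α) *
      ((∏ i : Fin n, dg (α i.castSucc) (x i)) * dg (α (Fin.last n)) (1 - ∑ i, x i)) := by
  have hS : 0 < ∑ j, α j := Finset.sum_pos (fun j _ => hα j) Finset.univ_nonempty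
  have hB : 0 < multiBeta α := div_pos (Finset.prod_pos fun j _ => Real.Gamma_pos_of_pos (hα j))
    (Real.Gamma_pos_of_pos hS)
  unfold dirichletDensity
  split_ifs with h
  · rw [ENNReal.ofReal_mul (by positivity), Fin.prod_univ_castSucc]
    have h1 : 0 < 1 - ∑ i, x i := by linarith [h.2]
    simp only [Fin.snoc_castSucc, Fin.snoc_last]
    rw [ENNReal.ofReal_mul (Finset.prod_nonneg fun i _ => (Real.rpow_pos_of_pos (h.1 i) _).le),
      ENNReal.ofReal_prod_of_nonneg (fun i _ => (Real.rpow_pos_of_pos (h.1 i) _).le)]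
    simp only [dg, if_pos h1, if_pos (h.1 _)]
  · rw [ENNReal.ofReal_zero]
    by_cases hx : ∀ i, 0 < x i
    · rw [dg_zero (α (Fin.last n))]; simp
      have : ¬ (∑ i, x i < 1) := fun h' => h ⟨hx, h'⟩
      linarith
    · push Not at hx
      obtain ⟨i, hi⟩ := hx
      rw [Finset.prod_eq_zero (Finset.mem_univ i) (dg_zero _ hi)]; simp

lemma snoc_meas (n : ℕ) :
    Measurable (fun x : Fin n → ℝ => (Fin.snoc x (1 - ∑ i, x i) : Fin (n + 1) → ℝ)) := by
  refine measurable_pi_iff.mpr fun j => ?_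
  refine Fin.lastCases ?_ (fun i => ?_) j
  · simp only [Fin.snoc_last]; fun_prop
  · simp only [Fin.snoc_castSucc]; fun_prop

lemma dens_meas {n : ℕ} (α : Fin (n + 1) → ℝ) (hα : ∀ j, 0 < α j) :
    Measurable (fun x : Fin n → ℝ => ENNReal.ofReal (dirichletDensity α x)) := by
  simp only [dens_eq α hα]
  exact (Fmeas α (fun x : (Fin n → ℝ) => x) (fun _ => 1)
              measurable_id measurable_const).const_mul _

lemma multiBeta_pos {n : ℕ} (α : Fin (n + 1) → ℝ) (hα : ∀ j, 0 < α j) : 0 < multiBeta α :=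
  div_pos (Finset.prod_pos fun j _ => Real.Gamma_pos_of_pos (hα j))
    (Real.Gamma_pos_of_pos (Finset.sum_pos (fun j _ => hα j) Finset.univ_nonempty))

lemma dir_ae {n : ℕ} (α : Fin (n + 1) → ℝ) (hα : ∀ j, 0 < α j) :
    ∀ᵐ p ∂(dirichlet α), ∀ k, 0 < p k ∧ p k ≤ 1 := by
  unfold dirichlet
  rw [ae_map_iff (snoc_meas n).aemeasurable, ae_withDensity_iff (dens_meas α hα)]
  · refine Filter.Eventually.of_forall fun x hx k => ?_
    have h : (∀ i, 0 < x i) ∧ (∑ i, x i) < 1 := by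
      by_contra h
      exact hx (by simp [dirichletDensity, h])
    refine Fin.lastCases ?_ (fun i => ?_) k
    · simp only [Fin.snoc_last]
      have := Finset.sum_nonneg (fun i (_ : i ∈ Finset.univ) => (h.1 i).le)
      constructor <;> linarith [h.2]
    · simp only [Fin.snoc_castSucc]
      have := Finset.single_le_sum (fun i _ => (h.1 i).le) (Finset.mem_univ i)
      exact ⟨h.1 i, this.trans h.2.le⟩
  · simp only [Set.ofPred_forall]
    refine MeasurableSet.iInter fun k => ?_
    exact (measurableSet_lt measurable_const (measurable_pi_apply k)).inter
      (measurableSet_le (measurable_pi_apply k) measurable_const)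

lemma dg_mul_rpow (a t y : ℝ) : dg a y * ENNReal.ofReal (y ^ t) = dg (a + t) y := by
  by_cases hy : 0 < y
  · rw [dg, dg, if_pos hy, if_pos hy, ← ENNReal.ofReal_mul (by positivity), ← Real.rpow_add hy]
    congr 2; ring
  · rw [dg_zero _ (not_lt.mp hy), dg_zero _ (not_lt.mp hy), zero_mul]

lemma dir_moment {n : ℕ} (α : Fin (n + 1) → ℝ) (hα : ∀ j, 0 < α j) (k : Fin (n + 1)) (t : ℝ)
    (ht : 0 ≤ t) :
    ∫⁻ p, ENNReal.ofReal (p k ^ t) ∂(dirichlet α) =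
      ENNReal.ofReal (multiBeta (α + Pi.single k t) / multiBeta α) := by
  have hα' : ∀ j, 0 < (α + Pi.single k t : Fin (n + 1) → ℝ) j := by
    intro j
    have : (0:ℝ) ≤ (Pi.single k t : Fin (n + 1) → ℝ) j := by
      by_cases h : j = k
      · subst h; simpa
      · simp [h]
    have := hα j
    simp only [Pi.add_apply]; linarith
  have hm : Measurable (fun p : Fin (n + 1) → ℝ => ENNReal.ofReal (p k ^ t)) := by fun_prop
  unfold dirichlet
  rw [lintegral_map hm (snoc_meas n)]
  refine (lintegral_withDensity_eq_lintegral_mul _ (dens_meas α hα)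
    (hm.comp (snoc_meas n))).trans ?_
  have hB := multiBeta_pos α hα
  rw [div_eq_inv_mul, ENNReal.ofReal_mul (by positivity), ← dir_int _ hα', ← lintegral_const_mul]
  · refine lintegral_congr fun x => ?_
    simp only [Pi.mul_apply, Function.comp, dens_eq α hα, one_div, mul_assoc]
    congr 1
    have e : ∀ β : Fin (n + 1) → ℝ, (∏ i : Fin n, dg (β i.castSucc) (x i)) *
      dg (β (Fin.last n)) (1 - ∑ i, x i) = ∏ j, dg (β j)
        ((Fin.snoc x (1 - ∑ i, x i) : Fin (n + 1) → ℝ) j) := by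
      intro β; rw [Fin.prod_univ_castSucc]; simp only [Fin.snoc_castSucc, Fin.snoc_last]
    rw [← mul_assoc, e, e, ← Finset.mul_prod_erase _ _ (Finset.mem_univ k),
      ← Finset.mul_prod_erase _ _ (Finset.mem_univ k), mul_right_comm, dg_mul_rpow]
    congr 1
    · simp
    · refine Finset.prod_congr rfl fun j hj => ?_
      simp [Finset.ne_of_mem_erase hj]
  · exact Fmeas _ (fun x : (Fin n → ℝ) => x) (fun _ => 1) measurable_id measurable_const

lemma dir_prob {n : ℕ} (α : Fin (n + 1) → ℝ) (hα : ∀ j, 0 < α j) :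
    IsProbabilityMeasure (dirichlet α) := by
  constructor
  have h := dir_moment α hα 0 0 le_rfl
  simpa [div_self (multiBeta_pos α hα).ne'] using h

lemma dir_moment_real {n : ℕ} (α : Fin (n + 1) → ℝ) (hα : ∀ j, 0 < α j) (k : Fin (n + 1)) (t : ℝ)
    (ht : 0 ≤ t) :
    ∫ p, p k ^ t ∂(dirichlet α) = (Real.Gamma (∑ j, α j) / Real.Gamma (α k)) *
      (Real.Gamma (α k + t) / Real.Gamma (∑ j, α j + t)) := by
  rw [integral_eq_lintegral_of_nonneg_ae, dir_moment α hα k t ht, ENNReal.toReal_ofReal]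
  · have hs : ∑ j, (α + Pi.single k t : Fin (n + 1) → ℝ) j = ∑ j, α j + t := by
      simp [Finset.sum_add_distrib]
    have hP : ∏ j ∈ Finset.univ.erase k, Real.Gamma ((α + Pi.single k t : Fin (n + 1) → ℝ) j) =
        ∏ j ∈ Finset.univ.erase k, Real.Gamma (α j) :=
      Finset.prod_congr rfl fun j hj => by simp [Finset.ne_of_mem_erase hj]
    have hP0 : ∏ j ∈ Finset.univ.erase k, Real.Gamma (α j) ≠ 0 :=
      Finset.prod_ne_zero_iff.mpr fun j _ => (Real.Gamma_pos_of_pos (hα j)).ne'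
    have hS : 0 < ∑ j, α j := Finset.sum_pos (fun j _ => hα j) Finset.univ_nonempty
    have h1 := (Real.Gamma_pos_of_pos hS).ne'
    have h2 := (Real.Gamma_pos_of_pos (hα k)).ne'
    have h3 := (Real.Gamma_pos_of_pos (add_pos_of_pos_of_nonneg hS ht)).ne'
    rw [multiBeta, multiBeta, hs, ← Finset.mul_prod_erase _ _ (Finset.mem_univ k),
      ← Finset.mul_prod_erase Finset.univ (fun j => Real.Gamma (α j)) (Finset.mem_univ k), hP]
    simp only [Pi.add_apply, Pi.single_eq_same]
    field_simp
  · refine (div_pos (multiBeta_pos _ ?_) (multiBeta_pos α hα)).le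
    intro j
    have : (0:ℝ) ≤ (Pi.single k t : Fin (n + 1) → ℝ) j := by
      by_cases h : j = k
      · subst h; simpa
      · simp [h]
    have := hα j
    simp only [Pi.add_apply]; linarith
  · filter_upwards [dir_ae α hα] with p hp
    exact (Real.rpow_pos_of_pos (hp k).1 t).le
  · exact Measurable.aestronglyMeasurable (by fun_prop)

lemma gamma_deriv {x : ℝ} (hx : 0 < x) :
    HasDerivAt Real.Gamma (Real.Gamma x * digamma x) x := by
  have hne : ∀ m : ℕ, x ≠ -m := fun m h => by
    have : (0:ℝ) ≤ m := m.cast_nonneg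
    linarith
  have h := (Real.differentiableAt_Gamma hne).hasDerivAt
  have hG := (Real.Gamma_pos_of_pos hx).ne'
  have h2 : digamma x = deriv Real.Gamma x / Real.Gamma x := (h.log hG).deriv
  rw [h2, mul_div_cancel₀ _ hG]
  exact h

lemma dir_log {n : ℕ} (α : Fin (n + 1) → ℝ) (hα : ∀ j, 0 < α j) (k : Fin (n + 1)) :
    Integrable (fun p => p k * Real.log (p k)) (dirichlet α) ∧
    ∫ p, p k * Real.log (p k) ∂(dirichlet α) =
      (α k / ∑ j, α j) * (digamma (α k + 1) - digamma (∑ j, α j + 1)) := by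
  have := dir_prob α hα
  have hS : 0 < ∑ j, α j := Finset.sum_pos (fun j _ => hα j) Finset.univ_nonempty
  set S := ∑ j, α j with hSdef
  have hd := hasDerivAt_integral_of_dominated_loc_of_deriv_le (μ := dirichlet α)
    (F := fun t p => p k ^ t) (F' := fun t p => p k ^ t * Real.log (p k)) (x₀ := (1:ℝ))
    (s := Set.Ioi (1/2)) (bound := fun _ => 2) (Ioi_mem_nhds (by norm_num))
    (Filter.Eventually.of_forall fun t => Measurable.aestronglyMeasurable (by fun_prop))
    (by
      refine Integrable.of_bound (Measurable.aestronglyMeasurable (by fun_prop)) 1 ?_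
      filter_upwards [dir_ae α hα] with p hp
      rw [Real.rpow_one, Real.norm_eq_abs, abs_of_pos (hp k).1]
      exact (hp k).2)
    (Measurable.aestronglyMeasurable (by fun_prop))
    (by
      filter_upwards [dir_ae α hα] with p hp t ht
      have ht' : (1/2 : ℝ) < t := ht
      have h := Real.abs_log_mul_self_rpow_lt (p k) t (hp k).1 (hp k).2 (by linarith)
      rw [Real.norm_eq_abs, mul_comm]
      refine h.le.trans ?_
      rw [div_le_iff₀ (by linarith)]; linarith)
    (integrable_const _)
    (by
      filter_upwards [dir_ae α hα] with p hp t ht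
      exact Real.hasStrictDerivAt_const_rpow (hp k).1 t |>.hasDerivAt)
  simp only [Real.rpow_one] at hd
  refine ⟨hd.1, ?_⟩
  have hk := hα k
  have hk1 : 0 < α k + 1 := by linarith
  have hS1 : 0 < S + 1 := by linarith
  have g1 : HasDerivAt (fun t => Real.Gamma (α k + t)) _ 1 :=
    (gamma_deriv hk1).comp_const_add (α k) 1
  have g2 : HasDerivAt (fun t => Real.Gamma (S + t)) _ 1 :=
    (gamma_deriv hS1).comp_const_add S 1
  have n1 := (Real.Gamma_pos_of_pos hk).ne'
  have n2 := (Real.Gamma_pos_of_pos hS).ne'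
  have n3 := (Real.Gamma_pos_of_pos hS1).ne'
  have g3 := (g1.div g2 n3).const_mul (Real.Gamma S / Real.Gamma (α k))
  have heq : (fun t => ∫ p, p k ^ t ∂(dirichlet α)) =ᶠ[nhds 1]
      fun t => (Real.Gamma S / Real.Gamma (α k)) *
        (Real.Gamma (α k + t) / Real.Gamma (S + t)) := by
    filter_upwards [Ioi_mem_nhds (show (0:ℝ) < 1 by norm_num)] with t ht
    exact dir_moment_real α hα k t (le_of_lt ht)
  rw [hd.2.unique (g3.congr_of_eventuallyEq heq)]
  rw [Real.Gamma_add_one hk.ne', Real.Gamma_add_one hS.ne'] 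
  field_simp

/-- **Aleatoric uncertainty, Eq. (10).** If `p ~ Dir(α)` with all
`α j > 0` and `S = ∑ j, α j`, then the expected Shannon entropy satisfies
`E[H(p)] = ∑ k, (α k / S) (ψ(S + 1) - ψ(α k + 1))`, where
`H(p) = -∑ k, p k * log (p k)` and `ψ` is the digamma function. -/
theorem dirichlet_expected_entropy {n : ℕ} (α : Fin (n + 1) → ℝ) (hα : ∀ j, 0 < α j)
    (S : ℝ) (hS : S = ∑ i, α i) :
    ∫ p, (-∑ k, p k * Real.log (p k)) ∂(dirichlet α) =
      ∑ k, (α k / S) * (digamma (S + 1) - digamma (α k + 1)) := by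
  have hprob := dir_prob α hα
  rw [integral_neg, integral_finsetSum _ (fun k _ => (dir_log α hα k).1), ← Finset.sum_neg_distrib]
  refine Finset.sum_congr rfl fun k _ => ?_
  rw [(dir_log α hα k).2, hS]
  ring
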